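/- Let Q be a logic and A ⊆ Q. Then S(A) = [0, ⋁S(A)] ∩ L(A), i.e., the subcommutators of A are exactly the elements of the sublogic generated by A that lie below the maximum subcommutator ⋁S(A). -/

import Mathlib

/-- A *logic*: a complete orthomodular lattice. -/
class COL (Q : Type*) extends CompleteLattice Q where
  /-- orthocomplementation -/
  oc : Q → Q
  oc_antitone : ∀ {P R : Q}, P ≤ R → oc R ≤ oc P
  oc_oc : ∀ P : Q, oc (oc P) = P
  sup_oc : ∀ P : Q, P ⊔ oc P = ⊤
  inf_oc : ∀ P : Q, P ⊓ oc P = ⊥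
  orthomodular : ∀ {P R : Q}, P ≤ R → P ⊔ (oc P ⊓ R) = R

variable {Q : Type*} [COL Q]

/-- `P` commutes with `R`, written `P ∘ R` in the paper. -/
def COL.commutes (P R : Q) : Prop := P = (P ⊓ R) ⊔ (P ⊓ COL.oc R)

/-- The commutant `A^!` of a subset `A` of a logic. -/
def COL.commutant (A : Set Q) : Set Q := {P : Q | ∀ R ∈ A, COL.commutes P R}

/-- The sublogic `L(A) = A^!!` generated by `A`. -/
def COL.Lgen (A : Set Q) : Set Q := COL.commutant (COL.commutant A)

/-- The center `Z(A) = A^! ∩ A^!!` of the sublogic generated by `A`. -/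
def COL.Zcen (A : Set Q) : Set Q := COL.commutant A ∩ COL.Lgen A

/-- The set `S(A)` of subcommutators of `A`. -/
def COL.subcom (A : Set Q) : Set Q :=
  {E : Q | E ∈ COL.Zcen A ∧ ∀ P1 ∈ A, ∀ P2 ∈ A, COL.commutes (P1 ⊓ E) (P2 ⊓ E)}

/-- Takeuti's commutator `com(A)`. -/
def COL.com (A : Set Q) : Q :=
  sSup {E : Q | E ∈ COL.commutant A ∧ ∀ P1 ∈ A, ∀ P2 ∈ A, COL.commutes (P1 ⊓ E) (P2 ⊓ E)}

namespace COL

theorem le_oc_of_le_oc {P R : Q} (h : P ≤ oc R) : R ≤ oc P := by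
  simpa only [oc_oc] using oc_antitone h

theorem oc_sup (P R : Q) : oc (P ⊔ R) = oc P ⊓ oc R :=
  le_antisymm (le_inf (oc_antitone le_sup_left) (oc_antitone le_sup_right))
    (le_oc_of_le_oc (sup_le (le_oc_of_le_oc inf_le_left) (le_oc_of_le_oc inf_le_right)))

theorem oc_inf (P R : Q) : oc (P ⊓ R) = oc P ⊔ oc R := by
  rw [← oc_oc (oc P ⊔ oc R), oc_sup, oc_oc, oc_oc]

theorem commutes_iff_le {P R : Q} : commutes P R ↔ P ≤ (P ⊓ R) ⊔ (P ⊓ oc R) :=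
  ⟨fun h => h.le, fun h => le_antisymm h (sup_le inf_le_left inf_le_left)⟩

theorem commutes_of_le {P R : Q} (h : P ≤ R) : commutes P R :=
  commutes_iff_le.2 (le_sup_of_le_left (le_inf le_rfl h))

theorem commutes_of_le_oc {P R : Q} (h : P ≤ oc R) : commutes P R :=
  commutes_iff_le.2 (le_sup_of_le_right (le_inf le_rfl h))

theorem commutes.oc_right {P R : Q} (h : commutes P R) : commutes P (oc R) := by
  unfold commutes at h ⊢
  rwa [oc_oc, sup_comm]

theorem commutes.inf_sup_oc_le {P R : Q} (h : commutes P R) :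
    R ⊓ (oc R ⊔ oc P) ≤ oc P := by
  have hP : oc P = (oc P ⊔ oc R) ⊓ (oc P ⊔ R) := by
    conv_lhs => rw [h]
    rw [oc_sup, oc_inf, oc_inf, oc_oc]
  rw [hP]
  refine le_inf ?_ (inf_le_left.trans le_sup_right)
  rw [← hP, sup_comm]
  exact inf_le_right

theorem commutes.symm {P R : Q} (h : commutes P R) : commutes R P := by
  rw [commutes_iff_le]
  calc R = (R ⊓ P) ⊔ (oc (R ⊓ P) ⊓ R) := (orthomodular inf_le_left).symm
    _ ≤ (R ⊓ P) ⊔ (R ⊓ oc P) := by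
      refine sup_le_sup_left (le_inf inf_le_right ?_) _
      rw [oc_inf, inf_comm]
      exact h.inf_sup_oc_le

theorem commutes.oc_left {P R : Q} (h : commutes P R) : commutes (oc P) R :=
  h.symm.oc_right.symm

theorem commutes_sSup_left {s : Set Q} {P : Q} (h : ∀ R ∈ s, commutes R P) :
    commutes (sSup s) P := by
  rw [commutes_iff_le]
  refine sSup_le fun R hR => (h R hR).le.trans ?_
  exact sup_le_sup (inf_le_inf_right _ (le_sSup hR)) (inf_le_inf_right _ (le_sSup hR))

theorem commutes.sup_left {P R T : Q} (hP : commutes P T) (hR : commutes R T) :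
    commutes (P ⊔ R) T := by
  rw [← sSup_pair]
  exact commutes_sSup_left (by simp [hP, hR])

theorem commutes.inf_left {P R T : Q} (hP : commutes P T) (hR : commutes R T) :
    commutes (P ⊓ R) T := by
  simpa only [oc_sup, oc_oc] using (hP.oc_left.sup_left hR.oc_left).oc_left

/-- An element distributes over the supremum of a set of elements commuting with it. -/
theorem inf_sSup_eq_of_commutes {s : Set Q} {P : Q} (h : ∀ R ∈ s, commutes R P) :
    P ⊓ sSup s = sSup ((P ⊓ ·) '' s) := by
  set a := sSup ((P ⊓ ·) '' s)
  have ha : a ≤ P ⊓ sSup s := by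
    refine sSup_le ?_
    rintro _ ⟨R, hR, rfl⟩
    exact inf_le_inf_left _ (le_sSup hR)
  have hs : sSup s ≤ oc (oc a ⊓ P) := by
    refine sSup_le fun R hR => le_oc_of_le_oc ?_
    refine le_trans (le_inf inf_le_right ?_) (h R hR).inf_sup_oc_le
    rw [← oc_inf]
    exact inf_le_left.trans (oc_antitone (le_sSup ⟨R, hR, rfl⟩))
  have hbot : oc a ⊓ (P ⊓ sSup s) = ⊥ := by
    rw [← inf_assoc, eq_bot_iff, ← inf_oc (oc a ⊓ P)]
    exact inf_le_inf_left _ hs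
  rw [← orthomodular ha, hbot, sup_bot_eq]

/-- Commutation with `P` can be tested on the parts of `P` below `F` and `oc F`. -/
theorem commutes_of_le_of_commutes_inf {X F P : Q} (hX : X ≤ F) (hP : commutes P F)
    (h : commutes X (P ⊓ F)) : commutes X P := by
  rw [hP]
  refine (h.symm.sup_left (commutes.symm (commutes_of_le_oc ?_))).symm
  exact hX.trans (le_oc_of_le_oc inf_le_right)

theorem subset_Lgen (A : Set Q) : A ⊆ Lgen A := fun _ hP _ hR => (hR _ hP).symm

theorem inf_mem_commutant_of_mem_subcom {A : Set Q} {P F : Q} (hP : P ∈ A)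
    (hF : F ∈ subcom A) : P ⊓ F ∈ commutant A := fun R hR =>
  commutes_of_le_of_commutes_inf inf_le_right (hF.1.1 R hR).symm (hF.2 P hP R hR)

theorem inf_sSup_subcom_mem_commutant {A : Set Q} {P : Q} (hP : P ∈ A) :
    P ⊓ sSup (subcom A) ∈ commutant A := by
  intro R hR
  rw [inf_sSup_eq_of_commutes fun F hF => hF.1.1 P hP]
  refine commutes_sSup_left ?_
  rintro _ ⟨F, hF, rfl⟩
  exact inf_mem_commutant_of_mem_subcom hP hF R hR

end COL

/-- Theorem 2.5 (iii): `S(A) = [0, ⋁S(A)] ∩ L(A)`. -/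
theorem stmt3 (A : Set Q) :
    COL.subcom A = Set.Icc ⊥ (sSup (COL.subcom A)) ∩ COL.Lgen A := by
  refine Set.Subset.antisymm (fun E hE => ⟨⟨bot_le, le_sSup hE⟩, hE.1.2⟩) ?_
  rintro E ⟨⟨-, hEM⟩, hEL⟩
  have hE_inf : ∀ P ∈ A, COL.commutes E (P ⊓ sSup (COL.subcom A)) := fun P hP =>
    hEL _ (COL.inf_sSup_subcom_mem_commutant hP)
  have hEA : E ∈ COL.commutant A := fun P hP =>
    COL.commutes_of_le_of_commutes_inf hEM
      (COL.commutes_sSup_left fun F hF => hF.1.1 P hP).symm (hE_inf P hP)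
  refine ⟨⟨hEA, hEL⟩, fun P₁ h₁ P₂ h₂ => ?_⟩
  have hP₂ : COL.commutes (P₁ ⊓ E) P₂ := by
    rw [← inf_eq_right.2 hEM, ← inf_assoc]
    exact (COL.inf_sSup_subcom_mem_commutant h₁ P₂ h₂).inf_left (hEA P₂ h₂)
  exact (hP₂.symm.inf_left (COL.commutes_of_le inf_le_right).symm).symm
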